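/- arXiv:2410.09669 — 2 statements merged into one kernel-verified Lean document; each statement's English description precedes it below -/
import Mathlib

section
/- Let Ψ : ℝ² → ℝ be a smooth solution of the Klein–Gordon equation Ψ_y − Ψ_x = 2 Ψ_{xy}, and suppose there exist real constants c, b such that (c Ψ(x,y) + b) Ψ_x(x,y) = −e^{x−y} and (c Ψ(x,y) + b) Ψ_y(x,y) = e^{x−y} for all (x,y) ∈ ℝ². Then c = 0, b ≠ 0, and Ψ is linear in e^{x−y}: there exist real constants p ≠ 0 and q such that Ψ(x,y) = p e^{x−y} + q for all (x,y) (in fact p = −1/b). -/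
/-- Partial derivative with respect to the first variable `x`. -/
noncomputable def pdx (f : ℝ → ℝ → ℝ) (x y : ℝ) : ℝ := deriv (fun s => f s y) x

/-- Partial derivative with respect to the second variable `y`. -/
noncomputable def pdy (f : ℝ → ℝ → ℝ) (x y : ℝ) : ℝ := deriv (fun s => f x s) y

theorem hasDerivAt_pdx {f : ℝ → ℝ → ℝ} (hf : Differentiable ℝ (Function.uncurry f)) (x y : ℝ) :
    HasDerivAt (fun s => f s y) (pdx f x y) x := by
  have h : Differentiable ℝ fun s => Function.uncurry f (s, y) := hf.comp (by fun_prop)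
  exact (h x).hasDerivAt

theorem hasDerivAt_pdy {f : ℝ → ℝ → ℝ} (hf : Differentiable ℝ (Function.uncurry f)) (x y : ℝ) :
    HasDerivAt (fun s => f x s) (pdy f x y) y := by
  have h : Differentiable ℝ fun s => Function.uncurry f (x, s) := hf.comp (by fun_prop)
  exact (h y).hasDerivAt

theorem hasDerivAt_exp_sub_left (x y : ℝ) :
    HasDerivAt (fun s => Real.exp (s - y)) (Real.exp (x - y)) x := by
  simpa using ((hasDerivAt_id x).sub_const y).exp

theorem hasDerivAt_exp_sub_right (x y : ℝ) :
    HasDerivAt (fun s => Real.exp (x - s)) (-Real.exp (x - y)) y := by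
  simpa using ((hasDerivAt_id y).const_sub x).exp

/-- A function with the partial derivatives of `p e^{x−y}` differs from it by a constant. -/
theorem eq_const_mul_exp_add_of_partials {f : ℝ → ℝ → ℝ} {p : ℝ}
    (hx : ∀ x y, HasDerivAt (fun s => f s y) (p * Real.exp (x - y)) x)
    (hy : ∀ x y, HasDerivAt (fun s => f x s) (-(p * Real.exp (x - y))) y) (x y : ℝ) :
    f x y = p * Real.exp (x - y) + (f 0 0 - p) := by
  have dx (x y : ℝ) : HasDerivAt (fun s => f s y - p * Real.exp (s - y)) 0 x := by
    simpa using (hx x y).fun_sub ((hasDerivAt_exp_sub_left x y).const_mul p)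
  have dy (x y : ℝ) : HasDerivAt (fun s => f x s - p * Real.exp (x - s)) 0 y := by
    simpa using (hy x y).fun_sub ((hasDerivAt_exp_sub_right x y).const_mul p)
  have h1 := is_const_of_deriv_eq_zero (fun s => (dx s y).differentiableAt)
    (fun s => (dx s y).deriv) x 0
  have h2 := is_const_of_deriv_eq_zero (fun s => (dy 0 s).differentiableAt)
    (fun s => (dy 0 s).deriv) y 0
  simp only [sub_zero, Real.exp_zero, mul_one] at h1 h2
  linarith

/-- If a smooth solution `Ψ` of the Klein–Gordon equation `Ψ_y − Ψ_x = 2 Ψ_{xy}` satisfies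
`(cΨ + b)Ψ_x = −e^{x−y}` and `(cΨ + b)Ψ_y = e^{x−y}` identically for some constants
`c, b`, then `c = 0`, `b ≠ 0`, and `Ψ` is linear in `e^{x−y}`: there are constants
`p ≠ 0` (in fact `p = −1/b`) and `q` with `Ψ(x,y) = p e^{x−y} + q`. -/
theorem psi_linear_in_exponential
    (Ψ : ℝ → ℝ → ℝ) (hΨ : ContDiff ℝ (⊤ : ℕ∞) (Function.uncurry Ψ))
    (hKG : ∀ x y : ℝ, pdy Ψ x y - pdx Ψ x y = 2 * pdx (pdy Ψ) x y)
    (c b : ℝ)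
    (hx : ∀ x y : ℝ, (c * Ψ x y + b) * pdx Ψ x y = -Real.exp (x - y))
    (hy : ∀ x y : ℝ, (c * Ψ x y + b) * pdy Ψ x y = Real.exp (x - y)) :
    c = 0 ∧ b ≠ 0 ∧ ∃ p q : ℝ, p ≠ 0 ∧ p = -1 / b ∧
      ∀ x y : ℝ, Ψ x y = p * Real.exp (x - y) + q := by
  have hd : Differentiable ℝ (Function.uncurry Ψ) := hΨ.differentiable (by simp)
  have hu (x y : ℝ) : c * Ψ x y + b ≠ 0 := fun h => by
    have := hy x y
    rw [h, zero_mul] at this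
    exact (Real.exp_pos _).ne this
  have hpx (x y : ℝ) : pdx Ψ x y = -Real.exp (x - y) / (c * Ψ x y + b) :=
    (eq_div_iff (hu x y)).2 (by rw [← hx x y, mul_comm])
  have hpy (x y : ℝ) : pdy Ψ x y = Real.exp (x - y) / (c * Ψ x y + b) :=
    (eq_div_iff (hu x y)).2 (by rw [← hy x y, mul_comm])
  have hc : c = 0 := by
    have hmixed : pdx (pdy Ψ) 0 0 = (Real.exp (0 - 0) * (c * Ψ 0 0 + b)
        - Real.exp (0 - 0) * (c * pdx Ψ 0 0)) / (c * Ψ 0 0 + b) ^ 2 := by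
      have h := (hasDerivAt_exp_sub_left 0 0).div
        (((hasDerivAt_pdx hd 0 0).const_mul c).add_const b) (hu 0 0)
      rw [pdx, funext fun s => hpy s 0]
      exact h.deriv
    have hk := hKG 0 0
    have h0 := hu 0 0
    rw [hmixed, hpx, hpy] at hk
    simp only [sub_zero, Real.exp_zero] at hk
    field_simp at hk
    linarith
  subst hc
  have hb : b ≠ 0 := by simpa using hu 0 0
  refine ⟨rfl, hb, -1 / b, Ψ 0 0 - -1 / b, by simp [hb], rfl, ?_⟩
  refine eq_const_mul_exp_add_of_partials (fun x y => ?_) fun x y => ?_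
  · convert hasDerivAt_pdx hd x y using 1
    rw [hpx]
    ring
  · convert hasDerivAt_pdy hd x y using 1
    rw [hpy]
    ring
end

section
/- Let Θ : ℝ → ℝ be smooth, let r = (r¹,r²,r³) : ℝ² → ℝ³ be a smooth solution (in (t,x)) of the diagonal system S: r¹_t + V¹ r¹_x = 0, r²_t + V² r²_x = 0, r³_t + V³ r³_x = 0 with V¹ = r¹+r²+1, V² = r¹+r²−1, V³ = r¹+r², and let λ = (λ₁,λ₂,λ₃) : ℝ² → ℝ³ be a smooth solution of the cotangent (adjoint linearized) system on this solution: ∂_t λ₁ + ∂_x(V¹ λ₁) = r¹_x λ₁ + r²_x λ₂ + r³_x λ₃, ∂_t λ₂ + ∂_x(V² λ₂) = r¹_x λ₁ + r²_x λ₂ + r³_x λ₃, ∂_t λ₃ + ∂_x(V³ λ₃) = 0. Define η^i := (H¹_Θ λ)^i, i.e., η¹ = e^{r²−r¹}(−∂_xλ₁ − ½((r²_x−r¹_x)λ₁ + (r¹_x−r²_x)λ₂ − 2r³_x λ₃)), η² = e^{r²−r¹}(∂_xλ₂ − ½((r²_x−r¹_x)λ₁ + (r¹_x−r²_x)λ₂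 − 2r³_x λ₃)), η³ = e^{r²−r¹}(e^{r²−r¹}Θ(r³)∂_xλ₃ − ½(2r³_x λ₁ + 2r³_x λ₂ + f³³ λ₃)) with f³³ = −e^{r²−r¹}(2(r²_x−r¹_x)Θ(r³) + r³_x Θ'(r³)). Then η = (η¹,η²,η³) solves the tangent (linearized) system: ∂_t η^i + V^i ∂_x η^i + (η¹ + η²) ∂_x r^i = 0 for i = 1,2,3. In other words, H¹_Θ is a Noether operator of S: it maps cosymmetries of S to symmetries of S. -/
/-- Partial derivative with respect to the first variable `t`. -/
noncomputable def pt (f : ℝ → ℝ → ℝ) (t x : ℝ) : ℝ := deriv (fun s => f s x) t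

/-- Partial derivative with respect to the second variable `x`. -/
noncomputable def px (f : ℝ → ℝ → ℝ) (t x : ℝ) : ℝ := deriv (fun s => f t s) x

section PartialDerivatives

variable {f : ℝ → ℝ → ℝ}

lemma hasDerivAt_fst_fderiv (hf : Differentiable ℝ (Function.uncurry f)) (t x : ℝ) :
    HasDerivAt (fun s => f s x) (fderiv ℝ (Function.uncurry f) (t, x) (1, 0)) t :=
  (hf (t, x)).hasFDerivAt.comp_hasDerivAt (f := fun s => (s, x)) t
    ((hasDerivAt_id t).prodMk (hasDerivAt_const t x))

lemma hasDerivAt_snd_fderiv (hf : Differentiable ℝ (Function.uncurry f)) (t x : ℝ) :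
    HasDerivAt (fun s => f t s) (fderiv ℝ (Function.uncurry f) (t, x) (0, 1)) x :=
  (hf (t, x)).hasFDerivAt.comp_hasDerivAt (f := fun s => (t, s)) x
    ((hasDerivAt_const x t).prodMk (hasDerivAt_id x))

lemma pt_eq_fderiv (hf : Differentiable ℝ (Function.uncurry f)) (t x : ℝ) :
    pt f t x = fderiv ℝ (Function.uncurry f) (t, x) (1, 0) :=
  (hasDerivAt_fst_fderiv hf t x).deriv

lemma px_eq_fderiv (hf : Differentiable ℝ (Function.uncurry f)) (t x : ℝ) :
    px f t x = fderiv ℝ (Function.uncurry f) (t, x) (0, 1) :=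
  (hasDerivAt_snd_fderiv hf t x).deriv

lemma hasDerivAt_pt (hf : ContDiff ℝ (⊤ : ℕ∞) (Function.uncurry f)) (t x : ℝ) :
    HasDerivAt (fun s => f s x) (pt f t x) t := by
  have hd := hf.differentiable (by simp)
  exact (pt_eq_fderiv hd t x).symm ▸ hasDerivAt_fst_fderiv hd t x

lemma hasDerivAt_px (hf : ContDiff ℝ (⊤ : ℕ∞) (Function.uncurry f)) (t x : ℝ) :
    HasDerivAt (fun s => f t s) (px f t x) x := by
  have hd := hf.differentiable (by simp)
  exact (px_eq_fderiv hd t x).symm ▸ hasDerivAt_snd_fderiv hd t x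

lemma contDiff_px (hf : ContDiff ℝ (⊤ : ℕ∞) (Function.uncurry f)) :
    ContDiff ℝ (⊤ : ℕ∞) (Function.uncurry (px f)) := by
  have h : Function.uncurry (px f) = fun p => fderiv ℝ (Function.uncurry f) p (0, 1) :=
    funext fun p => px_eq_fderiv (hf.differentiable (by simp)) p.1 p.2
  rw [h]
  exact (hf.fderiv_right (m := (⊤ : ℕ∞)) (by simp)).clm_apply contDiff_const

/-- Symmetry of the mixed second partial derivatives of a smooth function. -/
lemma pt_px_comm (hf : ContDiff ℝ (⊤ : ℕ∞) (Function.uncurry f)) (t x : ℝ) :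
    pt (px f) t x = px (pt f) t x := by
  have hd := hf.differentiable (by simp)
  have hF : DifferentiableAt ℝ (fderiv ℝ (Function.uncurry f)) (t, x) :=
    (hf.fderiv_right (m := (⊤ : ℕ∞)) (by simp)).differentiable (by simp) _
  have h1 : HasDerivAt (fun s => fderiv ℝ (Function.uncurry f) (s, x))
      (fderiv ℝ (fderiv ℝ (Function.uncurry f)) (t, x) (1, 0)) t :=
    hF.hasFDerivAt.comp_hasDerivAt (f := fun s => (s, x)) t
    ((hasDerivAt_id t).prodMk (hasDerivAt_const t x))
  have h2 : HasDerivAt (fun s => fderiv ℝ (Function.uncurry f) (t, s))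
      (fderiv ℝ (fderiv ℝ (Function.uncurry f)) (t, x) (0, 1)) x :=
    hF.hasFDerivAt.comp_hasDerivAt (f := fun s => (t, s)) x
    ((hasDerivAt_const x t).prodMk (hasDerivAt_id x))
  have e1 : pt (px f) t x = fderiv ℝ (fderiv ℝ (Function.uncurry f)) (t, x) (1, 0) (0, 1) := by
    have := (h1.clm_apply (hasDerivAt_const t ((0, 1) : ℝ × ℝ))).deriv
    simpa [pt, px_eq_fderiv hd] using this
  have e2 : px (pt f) t x = fderiv ℝ (fderiv ℝ (Function.uncurry f)) (t, x) (0, 1) (1, 0) := by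
    have := (h2.clm_apply (hasDerivAt_const x ((1, 0) : ℝ × ℝ))).deriv
    simpa [px, pt_eq_fderiv hd] using this
  rw [e1, e2]
  have h2 : minSmoothness ℝ 2 ≤ ((⊤ : ℕ∞) : WithTop ℕ∞) := by
    rw [minSmoothness_of_isRCLikeNormedField]
    exact WithTop.coe_le_coe.2 (le_top : (2 : ℕ∞) ≤ ⊤)
  exact (hf.contDiffAt.isSymmSndFDerivAt h2).eq _ _

/-- The mixed derivative `∂ₜ∂ₓ f` read off from an evolution equation `∂ₜ f = g`. -/
lemma pt_px_eq_of_pt_eq (hf : ContDiff ℝ (⊤ : ℕ∞) (Function.uncurry f)) {g : ℝ → ℝ → ℝ}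
    (hg : ∀ t x, pt f t x = g t x) {t x g' : ℝ} (h : HasDerivAt (fun s => g t s) g' x) :
    pt (px f) t x = g' := by
  rw [pt_px_comm hf, funext fun t => funext fun x => hg t x]
  exact h.deriv

end PartialDerivatives

section OneVariable

variable {r1 r2 l1 l2 l3 p1 p2 p3 q3 T T1 : ℝ → ℝ}
  {r1' r2' l1' l2' l3' p1' p2' p3' q3' T' T1' s : ℝ}

lemma hasDerivAt_exp_diff_mul {g : ℝ → ℝ} {g' : ℝ} (hr1 : HasDerivAt r1 r1' s)
    (hr2 : HasDerivAt r2 r2' s) (hg : HasDerivAt g g' s) :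
    HasDerivAt (fun s => Real.exp (r2 s - r1 s) * g s)
      (Real.exp (r2 s - r1 s) * ((r2' - r1') * g s + g')) s :=
  (((hr2.sub hr1).exp).mul hg).congr_deriv (by simp only [Pi.sub_apply]; ring)

/-- The derivative of the part `½ (M λ)` shared by the first two components of `H¹_Θ λ`. -/
lemma hasDerivAt_half_coupling (hl1 : HasDerivAt l1 l1' s) (hl2 : HasDerivAt l2 l2' s)
    (hl3 : HasDerivAt l3 l3' s) (hp1 : HasDerivAt p1 p1' s) (hp2 : HasDerivAt p2 p2' s)
    (hp3 : HasDerivAt p3 p3' s) :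
    HasDerivAt (fun s => (1 / 2) * ((p2 s - p1 s) * l1 s + (p1 s - p2 s) * l2 s
        - 2 * p3 s * l3 s))
      ((1 / 2) * ((p2' - p1') * l1 s + (p2 s - p1 s) * l1' + (p1' - p2') * l2 s
        + (p1 s - p2 s) * l2' - 2 * p3' * l3 s - 2 * p3 s * l3')) s :=
  (((((hp2.sub hp1).mul hl1).add ((hp1.sub hp2).mul hl2)).sub
    ((hp3.const_mul 2).mul hl3)).const_mul (1 / 2)).congr_deriv
      (by simp only [Pi.sub_apply]; ring)

/-- The derivative of the third component of `H¹_Θ λ`, where `T = Θ(r³)`, `T1 = Θ'(r³)`,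
`pᵢ = ∂ₓrⁱ` and `q3 = ∂ₓλ₃`. -/
lemma hasDerivAt_third_component (hr1 : HasDerivAt r1 r1' s) (hr2 : HasDerivAt r2 r2' s)
    (hl1 : HasDerivAt l1 l1' s) (hl2 : HasDerivAt l2 l2' s) (hl3 : HasDerivAt l3 l3' s)
    (hp1 : HasDerivAt p1 p1' s) (hp2 : HasDerivAt p2 p2' s) (hp3 : HasDerivAt p3 p3' s)
    (hq3 : HasDerivAt q3 q3' s) (hT : HasDerivAt T T' s) (hT1 : HasDerivAt T1 T1' s) :
    HasDerivAt (fun s => Real.exp (r2 s - r1 s) * (Real.exp (r2 s - r1 s) * T s * q3 s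
        - (1 / 2) * (2 * p3 s * l1 s + 2 * p3 s * l2 s
          + -Real.exp (r2 s - r1 s) * (2 * (p2 s - p1 s) * T s + p3 s * T1 s) * l3 s)))
      (Real.exp (r2 s - r1 s) * ((r2' - r1') * (2 * Real.exp (r2 s - r1 s) * (T s * q3 s
          + (1 / 2) * (2 * (p2 s - p1 s) * T s + p3 s * T1 s) * l3 s)
          - p3 s * (l1 s + l2 s))
        + Real.exp (r2 s - r1 s) * (T' * q3 s + T s * q3'
          + (1 / 2) * ((2 * (p2' - p1') * T s + 2 * (p2 s - p1 s) * T' + p3' * T1 s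
            + p3 s * T1') * l3 s + (2 * (p2 s - p1 s) * T s + p3 s * T1 s) * l3'))
        - p3' * (l1 s + l2 s) - p3 s * (l1' + l2'))) s := by
  have hE := (hr2.sub hr1).exp
  have h33 := hE.neg.mul ((((hp2.sub hp1).const_mul 2).mul hT).add (hp3.mul hT1))
  have h := hE.mul (((hE.mul hT).mul hq3).sub ((((((hp3.const_mul 2).mul hl1).add
    ((hp3.const_mul 2).mul hl2)).add (h33.mul hl3))).const_mul (1 / 2)))
  refine h.congr_deriv ?_
  simp only [Pi.sub_apply, Pi.add_apply, Pi.mul_apply, Pi.neg_apply]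
  ring

end OneVariable

/-- The operator `H¹_Θ` is a Noether operator of the diagonal drift-flux system `S`:
whenever `r = (r¹,r²,r³)` is a smooth solution of `S` (with characteristic speeds
`V¹ = r¹+r²+1`, `V² = r¹+r²−1`, `V³ = r¹+r²`) and `λ = (λ₁,λ₂,λ₃)` is a smooth solution
of the cotangent (adjoint linearized) system on this solution, the triple
`η = H¹_Θ λ` solves the tangent (linearized) system of `S`; that is, `H¹_Θ` maps
cosymmetries of `S` to symmetries of `S`. -/
theorem Hop_is_Noether_operator
    (Θ : ℝ → ℝ) (hΘ : ContDiff ℝ (⊤ : ℕ∞) Θ)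
    (r1 r2 r3 l1 l2 l3 : ℝ → ℝ → ℝ)
    (hr1 : ContDiff ℝ (⊤ : ℕ∞) (Function.uncurry r1))
    (hr2 : ContDiff ℝ (⊤ : ℕ∞) (Function.uncurry r2))
    (hr3 : ContDiff ℝ (⊤ : ℕ∞) (Function.uncurry r3))
    (hl1 : ContDiff ℝ (⊤ : ℕ∞) (Function.uncurry l1))
    (hl2 : ContDiff ℝ (⊤ : ℕ∞) (Function.uncurry l2))
    (hl3 : ContDiff ℝ (⊤ : ℕ∞) (Function.uncurry l3))
    -- the diagonal system S
    (hS1 : ∀ t x, pt r1 t x + (r1 t x + r2 t x + 1) * px r1 t x = 0)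
    (hS2 : ∀ t x, pt r2 t x + (r1 t x + r2 t x - 1) * px r2 t x = 0)
    (hS3 : ∀ t x, pt r3 t x + (r1 t x + r2 t x) * px r3 t x = 0)
    -- the cotangent (adjoint linearized) system
    (hc1 : ∀ t x, pt l1 t x
        + px (fun t x => (r1 t x + r2 t x + 1) * l1 t x) t x
      = px r1 t x * l1 t x + px r2 t x * l2 t x + px r3 t x * l3 t x)
    (hc2 : ∀ t x, pt l2 t x
        + px (fun t x => (r1 t x + r2 t x - 1) * l2 t x) t x
      = px r1 t x * l1 t x + px r2 t x * l2 t x + px r3 t x * l3 t x)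
    (hc3 : ∀ t x, pt l3 t x
        + px (fun t x => (r1 t x + r2 t x) * l3 t x) t x = 0) :
    -- η := H¹_Θ λ
    let E : ℝ → ℝ → ℝ := fun t x => Real.exp (r2 t x - r1 t x)
    let f33 : ℝ → ℝ → ℝ := fun t x =>
      -E t x * (2 * (px r2 t x - px r1 t x) * Θ (r3 t x)
        + px r3 t x * deriv Θ (r3 t x))
    let η1 : ℝ → ℝ → ℝ := fun t x =>
      E t x * (-(px l1 t x) - (1 / 2) * ((px r2 t x - px r1 t x) * l1 t x
        + (px r1 t x - px r2 t x) * l2 t x - 2 * px r3 t x * l3 t x))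
    let η2 : ℝ → ℝ → ℝ := fun t x =>
      E t x * (px l2 t x - (1 / 2) * ((px r2 t x - px r1 t x) * l1 t x
        + (px r1 t x - px r2 t x) * l2 t x - 2 * px r3 t x * l3 t x))
    let η3 : ℝ → ℝ → ℝ := fun t x =>
      E t x * (E t x * Θ (r3 t x) * px l3 t x - (1 / 2) * (2 * px r3 t x * l1 t x
        + 2 * px r3 t x * l2 t x + f33 t x * l3 t x))
    -- η solves the tangent (linearized) system
    (∀ t x, pt η1 t x + (r1 t x + r2 t x + 1) * px η1 t x
      + (η1 t x + η2 t x) * px r1 t x = 0) ∧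
    (∀ t x, pt η2 t x + (r1 t x + r2 t x - 1) * px η2 t x
      + (η1 t x + η2 t x) * px r2 t x = 0) ∧
    (∀ t x, pt η3 t x + (r1 t x + r2 t x) * px η3 t x
      + (η1 t x + η2 t x) * px r3 t x = 0) := by
  intro E f33 η1 η2 η3
  have hΘ' : ContDiff ℝ (⊤ : ℕ∞) (deriv Θ) := (contDiff_infty_iff_deriv.1 hΘ).2
  have dΘ : ∀ y, HasDerivAt Θ (deriv Θ y) y := fun y =>
    (hΘ.differentiable (by simp) y).hasDerivAt
  have dΘ' : ∀ y, HasDerivAt (deriv Θ) (deriv (deriv Θ) y) y := fun y =>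
    (hΘ'.differentiable (by simp) y).hasDerivAt
  have r1x := hasDerivAt_px hr1
  have r2x := hasDerivAt_px hr2
  have r3x := hasDerivAt_px hr3
  have l1x := hasDerivAt_px hl1
  have l2x := hasDerivAt_px hl2
  have l3x := hasDerivAt_px hl3
  have r1xx := hasDerivAt_px (contDiff_px hr1)
  have r2xx := hasDerivAt_px (contDiff_px hr2)
  have r3xx := hasDerivAt_px (contDiff_px hr3)
  have l1xx := hasDerivAt_px (contDiff_px hl1)
  have l2xx := hasDerivAt_px (contDiff_px hl2)
  have l3xx := hasDerivAt_px (contDiff_px hl3)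
  have V1x : ∀ t x, HasDerivAt (fun s => r1 t s + r2 t s + 1) (px r1 t x + px r2 t x) x :=
    fun t x => ((r1x t x).add (r2x t x)).add_const 1
  have V2x : ∀ t x, HasDerivAt (fun s => r1 t s + r2 t s - 1) (px r1 t x + px r2 t x) x :=
    fun t x => ((r1x t x).add (r2x t x)).sub_const 1
  have V3x : ∀ t x, HasDerivAt (fun s => r1 t s + r2 t s) (px r1 t x + px r2 t x) x :=
    fun t x => (r1x t x).add (r2x t x)
  have r1t : ∀ t x, pt r1 t x = -((r1 t x + r2 t x + 1) * px r1 t x) :=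
    fun t x => by linear_combination hS1 t x
  have r2t : ∀ t x, pt r2 t x = -((r1 t x + r2 t x - 1) * px r2 t x) :=
    fun t x => by linear_combination hS2 t x
  have r3t : ∀ t x, pt r3 t x = -((r1 t x + r2 t x) * px r3 t x) :=
    fun t x => by linear_combination hS3 t x
  have l1t : ∀ t x, pt l1 t x = px r1 t x * l1 t x + px r2 t x * l2 t x + px r3 t x * l3 t x
      - ((px r1 t x + px r2 t x) * l1 t x + (r1 t x + r2 t x + 1) * px l1 t x) := fun t x => by
    have h := ((V1x t x).mul (l1x t x)).deriv
    exact eq_sub_of_add_eq ((congrArg _ h.symm).trans (hc1 t x))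
  have l2t : ∀ t x, pt l2 t x = px r1 t x * l1 t x + px r2 t x * l2 t x + px r3 t x * l3 t x
      - ((px r1 t x + px r2 t x) * l2 t x + (r1 t x + r2 t x - 1) * px l2 t x) := fun t x => by
    have h := ((V2x t x).mul (l2x t x)).deriv
    exact eq_sub_of_add_eq ((congrArg _ h.symm).trans (hc2 t x))
  have l3t : ∀ t x, pt l3 t x =
      -((px r1 t x + px r2 t x) * l3 t x + (r1 t x + r2 t x) * px l3 t x) := fun t x => by
    have h := ((V3x t x).mul (l3x t x)).deriv
    exact eq_neg_of_add_eq_zero_left ((congrArg _ h.symm).trans (hc3 t x))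
  have Vxx := fun t x => (r1xx t x).add (r2xx t x)
  have Sx := fun t x => (((r1xx t x).mul (l1x t x)).add ((r2xx t x).mul (l2x t x))).add
    ((r3xx t x).mul (l3x t x))
  have r1xt := fun t x => pt_px_eq_of_pt_eq hr1 r1t ((V1x t x).mul (r1xx t x)).neg
  have r2xt := fun t x => pt_px_eq_of_pt_eq hr2 r2t ((V2x t x).mul (r2xx t x)).neg
  have r3xt := fun t x => pt_px_eq_of_pt_eq hr3 r3t ((V3x t x).mul (r3xx t x)).neg
  have l1xt := fun t x => pt_px_eq_of_pt_eq hl1 l1t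
    ((Sx t x).sub (((Vxx t x).mul (l1x t x)).add ((V1x t x).mul (l1xx t x))))
  have l2xt := fun t x => pt_px_eq_of_pt_eq hl2 l2t
    ((Sx t x).sub (((Vxx t x).mul (l2x t x)).add ((V2x t x).mul (l2xx t x))))
  have l3xt := fun t x => pt_px_eq_of_pt_eq hl3 l3t
    (((Vxx t x).mul (l3x t x)).add ((V3x t x).mul (l3xx t x))).neg
  simp only [Pi.add_apply] at r1xt r2xt r3xt l1xt l2xt l3xt
  have mx := fun t x => hasDerivAt_half_coupling (l1x t x) (l2x t x) (l3x t x)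
    (r1xx t x) (r2xx t x) (r3xx t x)
  have mt := fun t x => hasDerivAt_half_coupling (hasDerivAt_pt hl1 t x) (hasDerivAt_pt hl2 t x)
    (hasDerivAt_pt hl3 t x) (hasDerivAt_pt (contDiff_px hr1) t x)
    (hasDerivAt_pt (contDiff_px hr2) t x) (hasDerivAt_pt (contDiff_px hr3) t x)
  have Ex := fun (t x : ℝ) {g : ℝ → ℝ} {g' : ℝ} (hg : HasDerivAt g g' x) =>
    hasDerivAt_exp_diff_mul (r1x t x) (r2x t x) hg
  have Et := fun (t x : ℝ) {g : ℝ → ℝ} {g' : ℝ} (hg : HasDerivAt g g' t) =>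
    hasDerivAt_exp_diff_mul (hasDerivAt_pt hr1 t x) (hasDerivAt_pt hr2 t x) hg
  refine ⟨fun t x => ?_, fun t x => ?_, fun t x => ?_⟩
  · have hx : px η1 t x = _ := (Ex t x ((l1xx t x).neg.sub (mx t x))).deriv
    have ht : pt η1 t x = _ :=
      (Et t x ((hasDerivAt_pt (contDiff_px hl1) t x).neg.sub (mt t x))).deriv
    rw [hx, ht]
    simp only [η1, η2, E, Pi.sub_apply, Pi.neg_apply]
    rw [r1xt, r2xt, r3xt, l1xt, r1t, r2t, l1t, l2t, l3t]
    ring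
  · have hx : px η2 t x = _ := (Ex t x ((l2xx t x).sub (mx t x))).deriv
    have ht : pt η2 t x = _ :=
      (Et t x ((hasDerivAt_pt (contDiff_px hl2) t x).sub (mt t x))).deriv
    rw [hx, ht]
    simp only [η1, η2, E, Pi.sub_apply]
    rw [r1xt, r2xt, r3xt, l2xt, r1t, r2t, l1t, l2t, l3t]
    ring
  · have hx : px η3 t x = _ := (hasDerivAt_third_component (r1x t x) (r2x t x) (l1x t x)
      (l2x t x) (l3x t x) (r1xx t x) (r2xx t x) (r3xx t x) (l3xx t x)
      ((dΘ _).comp x (r3x t x)) ((dΘ' _).comp x (r3x t x))).deriv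
    have ht : pt η3 t x = _ := (hasDerivAt_third_component (hasDerivAt_pt hr1 t x)
      (hasDerivAt_pt hr2 t x) (hasDerivAt_pt hl1 t x) (hasDerivAt_pt hl2 t x)
      (hasDerivAt_pt hl3 t x) (hasDerivAt_pt (contDiff_px hr1) t x)
      (hasDerivAt_pt (contDiff_px hr2) t x) (hasDerivAt_pt (contDiff_px hr3) t x)
      (hasDerivAt_pt (contDiff_px hl3) t x) ((dΘ _).comp t (hasDerivAt_pt hr3 t x))
      ((dΘ' _).comp t (hasDerivAt_pt hr3 t x))).deriv
    rw [hx, ht]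
    simp only [η1, η2, E, Function.comp_apply]
    rw [r1xt, r2xt, r3xt, l3xt, r1t, r2t, r3t, l1t, l2t, l3t]
    ring
end
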